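/- arXiv:2307.14980 — 3 statements merged into one kernel-verified Lean document; each statement's English description precedes it below -/
import Mathlib

section
/- Let C > 0 and let P ≥ L > 0 be real numbers (P = T + L is the period of a TDMA schedule in which the gate is open for the first L time units of each period and closed for the remaining P − L). Define the cumulative TDMA service function f : ℝ≥0 → ℝ by f(x) = C·( ⌊x/P⌋·L + min(x − P·⌊x/P⌋, L) ). Then for all x ≥ 0, f(x) ≥ (C·L/P)·x; that is, the affine function with rate C·L/(T+L) is a lower envelope of the TDMA service curve. -/
/-- The affine function with rate `C·L/(T+L)` is a lower envelope of the
cumulative TDMA service curve: with period `P = T + L ≥ L > 0`, link rate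
`C > 0`, and `f(x) = C·(⌊x/P⌋·L + min(x − P·⌊x/P⌋, L))`, we have
`f(x) ≥ (C·L/P)·x` for all `x ≥ 0`. -/
theorem tdma_affine_lower_envelope
    (C L P : ℝ) (hC : C > 0) (hL : L > 0) (hPL : P ≥ L) :
    ∀ x : ℝ, 0 ≤ x →
      C * ((⌊x / P⌋ : ℝ) * L + min (x - P * (⌊x / P⌋ : ℝ)) L)
        ≥ (C * L / P) * x := by
  intro x _
  have hP : 0 < P := hL.trans_le hPL
  have hlo : (⌊x / P⌋ : ℝ) * P ≤ x := (le_div_iff₀ hP).mp (Int.floor_le _)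
  have hhi : x < ((⌊x / P⌋ : ℝ) + 1) * P := (div_lt_iff₀ hP).mp (Int.lt_floor_add_one _)
  generalize (⌊x / P⌋ : ℝ) = n at hlo hhi ⊢
  have key : L / P * (x - P * n) ≤ min (x - P * n) L := by
    refine le_min (mul_le_of_le_one_left (by linarith) ((div_le_one hP).mpr hPL)) ?_
    rw [div_mul_eq_mul_div, div_le_iff₀ hP]
    exact mul_le_mul_of_nonneg_left (by linarith) hL.le
  calc C * L / P * x = C * (n * L + L / P * (x - P * n)) := by
        field_simp
        ring
    _ ≤ C * (n * L + min (x - P * n) L) := by gcongr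
end

section
/- (802.1Qbv High-priority service curve.) Let C, L, T, δ, l be real numbers with C > 0, L > 0, T ≥ 0, δ ≥ 0, l ≥ 0, and set R = C·L/(T + L). Let A_q, D_q : ℝ≥0 → ℝ be nondecreasing with A_q(0) = D_q(0) = 0. Assume the non-preemptive strict-service property: for every t ≥ 0 there exists s ∈ [0, t] (a start of a backlog period) such that D_q(s) = A_q(s) and D_q(t) − D_q(s) ≥ R·max(t − s − δ, 0) − l. Then for every t ≥ 0, D_q(t) ≥ inf_{s ∈ [0, t]} ( A_q(s) + R·max( t − s − (δ + l/R), 0 ) ). In other words, the high-priority queue receives the rate–latency service curve β_q*(t) = R·[t − (δ + l/R)]^+ with rate R = C·L/(T + L) and latency δ + l/R. -/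
/-- 802.1Qbv high-priority service curve: if the high-priority queue `q` with
affine lower-envelope rate `R = C·L/(T+L)`, first gate opening `δ`, and
non-preemption penalty `l` (the maximum low-priority packet size) satisfies the
strict-service property `D_q t − D_q s ≥ R·[t − s − δ]⁺ − l` from some start
`s ∈ [0,t]` of a backlog period (`D_q s = A_q s`) for every `t ≥ 0`, then `q`
receives the rate–latency service curve with rate `R` and latency `δ + l/R`:
`D_q t ≥ inf_{s ∈ [0,t]} (A_q s + R·[t − s − (δ + l/R)]⁺)`. -/
theorem qbv_high_priority_service_curve
    (C L T δ l : ℝ) (hC : C > 0) (hL : L > 0) (hT : T ≥ 0)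
    (hδ : δ ≥ 0) (hl : l ≥ 0)
    (R : ℝ) (hR : R = C * L / (T + L))
    (A D : ℝ → ℝ)
    (hA : ∀ s t : ℝ, 0 ≤ s → s ≤ t → A s ≤ A t)
    (hD : ∀ s t : ℝ, 0 ≤ s → s ≤ t → D s ≤ D t)
    (hA0 : A 0 = 0) (hD0 : D 0 = 0)
    (hbacklog : ∀ t : ℝ, 0 ≤ t →
      ∃ s : ℝ, 0 ≤ s ∧ s ≤ t ∧ D s = A s ∧
        D t - D s ≥ R * max (t - s - δ) 0 - l) :
    ∀ t : ℝ, 0 ≤ t →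
      D t ≥ sInf ((fun s => A s + R * max (t - s - (δ + l / R)) 0) ''
        Set.Icc 0 t) := by
  intro t ht
  obtain ⟨s, hs0, hst, hDs, hserv⟩ := hbacklog t ht
  have hRpos : 0 < R := by
    rw [hR]
    exact div_pos (mul_pos hC hL) (by linarith)
  have hbdd : BddBelow ((fun s => A s + R * max (t - s - (δ + l / R)) 0) '' Set.Icc 0 t) := by
    refine ⟨0, ?_⟩
    rintro _ ⟨u, hu, rfl⟩
    have hAu : 0 ≤ A u := hA0 ▸ hA 0 u le_rfl hu.1
    positivity
  refine (csInf_le hbdd (Set.mem_image_of_mem _ ⟨hs0, hst⟩)).trans ?_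
  change A s + R * max (t - s - (δ + l / R)) 0 ≤ D t
  rcases max_cases (t - s - (δ + l / R)) 0 with ⟨h, -⟩ | ⟨h, -⟩
  · have hmax := mul_le_mul_of_nonneg_left (le_max_left (t - s - δ) 0) hRpos.le
    have hshift : R * (t - s - (δ + l / R)) = R * (t - s - δ) - l := by
      field_simp
      ring
    rw [h, hshift]
    linarith
  · rw [h]
    linarith [hD s t hs0 hst]
end

section
/- (802.1Qbv Low-priority service curve.) Let C, L′, T′, δ′, C_q, b be real numbers with C > 0, L′ > 0, T′ ≥ 0, δ′ ≥ 0, b ≥ 0, and set R′ = C·L′/(T′ + L′); assume R′ > C_q ≥ 0. Let A_{q'}, D_{q'}, A_q, D_q : ℝ≥0 → ℝ be nondecreasing with value 0 at 0, with D_q(t) ≤ A_q(t) for all t, and suppose the high-priority arrivals satisfy the affine arrival-curve constraint A_q(t) − A_q(s) ≤ C_q·(t − s) + b for all 0 ≤ s ≤ t. Assume that for every t ≥ 0 there exists s′ ∈ [0, t] (a start of a busy period) such that D_{q'}(s′) = A_{q'}(s′), D_q(s′) = A_q(s′), and the aggregate-service/leftover property D_{q'}(t) − D_{q'}(s′) ≥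 R′·max(t − s′ − δ′, 0) − (D_q(t) − D_q(s′)) holds. Then for every t ≥ 0, D_{q'}(t) ≥ inf_{s ∈ [0, t]} ( A_{q'}(s) + (R′ − C_q)·max( t − s − (R′·δ′ + b)/(R′ − C_q), 0 ) ). In other words, the low-priority queue receives the rate–latency service curve β_{q'}*(t) = (R′ − C_q)·[t − (R′·δ′ + b)/(R′ − C_q)]^+ with rate R′ − C_q and latency (R′·δ′ + b)/(R′ − C_q). -/
/-- 802.1Qbv low-priority service curve: the low-priority queue `q′`, opened
concurrently with a high-priority queue `q` constrained by the token-bucket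
arrival curve `γ_{C_q,b}`, with affine lower-envelope rate `R′ = C·L′/(T′+L′)`
and first gate opening `δ′`, and satisfying the leftover-service property
`D_{q′} t − D_{q′} s′ ≥ R′·[t − s′ − δ′]⁺ − (D_q t − D_q s′)` from some start
`s′ ∈ [0,t]` of a busy period, receives the rate–latency service curve with
rate `R′ − C_q` and latency `(R′·δ′ + b)/(R′ − C_q)`:
`D_{q′} t ≥ inf_{s ∈ [0,t]} (A_{q′} s + (R′ − C_q)·[t − s − (R′·δ′ + b)/(R′ − C_q)]⁺)`. -/
theorem qbv_low_priority_service_curve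
    (C L' T' δ' Cq b : ℝ) (hC : C > 0) (hL' : L' > 0) (hT' : T' ≥ 0)
    (hδ' : δ' ≥ 0) (hb : b ≥ 0)
    (R' : ℝ) (hR' : R' = C * L' / (T' + L'))
    (hRCq : R' > Cq) (hCq : Cq ≥ 0)
    (Aq' Dq' Aq Dq : ℝ → ℝ)
    (hAq' : ∀ s t : ℝ, 0 ≤ s → s ≤ t → Aq' s ≤ Aq' t)
    (hDq' : ∀ s t : ℝ, 0 ≤ s → s ≤ t → Dq' s ≤ Dq' t)
    (hAq : ∀ s t : ℝ, 0 ≤ s → s ≤ t → Aq s ≤ Aq t)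
    (hDq : ∀ s t : ℝ, 0 ≤ s → s ≤ t → Dq s ≤ Dq t)
    (hAq'0 : Aq' 0 = 0) (hDq'0 : Dq' 0 = 0)
    (hAq0 : Aq 0 = 0) (hDq0 : Dq 0 = 0)
    (hcausal : ∀ t : ℝ, 0 ≤ t → Dq t ≤ Aq t)
    (harr : ∀ s t : ℝ, 0 ≤ s → s ≤ t → Aq t - Aq s ≤ Cq * (t - s) + b)
    (hbusy : ∀ t : ℝ, 0 ≤ t →
      ∃ s' : ℝ, 0 ≤ s' ∧ s' ≤ t ∧ Dq' s' = Aq' s' ∧ Dq s' = Aq s' ∧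
        Dq' t - Dq' s' ≥ R' * max (t - s' - δ') 0 - (Dq t - Dq s')) :
    ∀ t : ℝ, 0 ≤ t →
      Dq' t ≥ sInf ((fun s =>
        Aq' s + (R' - Cq) * max (t - s - (R' * δ' + b) / (R' - Cq)) 0) ''
        Set.Icc 0 t) := by
  intro t ht
  obtain ⟨s, hs0, hst, hs', hs, hserv⟩ := hbusy t ht
  have hr : 0 < R' - Cq := sub_pos.mpr hRCq
  have hbdd : BddBelow ((fun s =>
      Aq' s + (R' - Cq) * max (t - s - (R' * δ' + b) / (R' - Cq)) 0) '' Set.Icc 0 t) := by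
    refine ⟨0, ?_⟩
    rintro _ ⟨u, ⟨hu0, -⟩, rfl⟩
    have hA : 0 ≤ Aq' u := hAq'0 ▸ hAq' 0 u le_rfl hu0
    exact add_nonneg hA (mul_nonneg hr.le (le_max_right _ _))
  refine (csInf_le hbdd ⟨s, ⟨hs0, hst⟩, rfl⟩).trans ?_
  dsimp only
  rcases max_cases (t - s - (R' * δ' + b) / (R' - Cq)) 0 with ⟨hm, -⟩ | ⟨hm, -⟩
  · have hmul : (R' - Cq) * (t - s - (R' * δ' + b) / (R' - Cq)) =
        (R' - Cq) * (t - s) - (R' * δ' + b) := by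
      field_simp
    have hmax : R' * (t - s - δ') ≤ R' * max (t - s - δ') 0 :=
      mul_le_mul_of_nonneg_left (le_max_left _ _) (hCq.le.trans hRCq.le)
    rw [hm, hmul]
    linarith [hcausal t ht, harr s t hs0 hst]
  · rw [hm]
    linarith [hDq' s t hs0 hst]
end
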